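/- arXiv:2505.24418 — 2 statements merged into one kernel-verified Lean document; each statement's English description precedes it below -/
import Mathlib

section
/- Let T ∈ ℝ, N ≥ 2, ρ₁, …, ρ_N > 0, and fix i ∈ {1,…,N}. Let u = (u₁,…,u_N) and ũ = (ũ₁,…,ũ_N) be tuples of continuous functions on (−∞,T] × [0,∞) with values in [0,1] such that: each u_j (resp. ũ_j) has continuous ∂_t, ∂_x, ∂_x² and satisfies ∂_t u_j ≤ ∂_x² u_j + f(u_j) (resp. ∂_t ũ_j ≥ ∂_x² ũ_j + f(ũ_j)) on (−∞,T] × [0,∞); for each t ≤ T, u₁(t,0) = ⋯ = u_N(t,0) and Σ_j ρ_j ∂_x u_j(t,0) ≥ 0 (sub-Kirchhoff), while ũ₁(t,0) = ⋯ = ũ_N(t,0) and Σ_j ρ_j ∂_x ũ_j(t,0) ≤ 0 (super-Kirchhoff). Suppose there is a smooth function b : (−∞,T] → [0,∞) with u_i(t, b(t)) < ũ_i(t, b(t)) for every t ≤ T, and 0 ≤ u_j(t,x) ≤ δ₀ whenever t ≤ T and either (j = i and 0 ≤ x ≤ b(t)) or (j ≠ i and x ≥ 0). Then u_j(t,x)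 < ũ_j(t,x) for all t ≤ T and all such pairs (j,x), i.e. for j = i with 0 ≤ x ≤ b(t) and for every j ≠ i with x ≥ 0. -/
open Set Filter Topology

/-- The primitive `F(s) = ∫₀^s f(r) dr`. -/
noncomputable def F (f : ℝ → ℝ) (s : ℝ) : ℝ := ∫ r in (0:ℝ)..s, f r

/-- Bistable nonlinearity with balanced-positive integral. -/
def Bistable (f : ℝ → ℝ) (a : ℝ) : Prop :=
  ContDiff ℝ 1 f ∧ 0 < a ∧ a < 1 ∧
  f 0 = 0 ∧ f a = 0 ∧ f 1 = 0 ∧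
  (∀ s, 0 < s → s < a → f s < 0) ∧
  (∀ s, a < s → s < 1 → 0 < f s) ∧
  deriv f 0 < 0 ∧ 0 < deriv f a ∧ deriv f 1 < 0 ∧
  0 < ∫ s in (0:ℝ)..(1:ℝ), f s


/-- `u` is a classical subsolution of `∂_t w = ∂_x² w + f(w)` on `(−∞,T] × [0,∞)`:
`u`, `∂_t u`, `∂_x u`, `∂_x² u` exist and are continuous there, and
`∂_t u ≤ ∂_x² u + f(u)`. -/
def IsSubSol (f : ℝ → ℝ) (T : ℝ) (u : ℝ → ℝ → ℝ) : Prop :=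
  ContinuousOn (fun p : ℝ × ℝ => u p.1 p.2) (Iic T ×ˢ Ici 0) ∧
  (∀ t, t ≤ T → ∀ x : ℝ, 0 ≤ x →
    DifferentiableAt ℝ (fun τ => u τ x) t ∧
    DifferentiableAt ℝ (u t) x ∧
    DifferentiableAt ℝ (deriv (u t)) x) ∧
  ContinuousOn (fun p : ℝ × ℝ => deriv (fun τ => u τ p.2) p.1) (Iic T ×ˢ Ici 0) ∧
  ContinuousOn (fun p : ℝ × ℝ => deriv (u p.1) p.2) (Iic T ×ˢ Ici 0) ∧
  ContinuousOn (fun p : ℝ × ℝ => deriv (deriv (u p.1)) p.2) (Iic T ×ˢ Ici 0) ∧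
  (∀ t, t ≤ T → ∀ x : ℝ, 0 ≤ x →
    deriv (fun τ => u τ x) t ≤ deriv (deriv (u t)) x + f (u t x))

/-- `ũ` is a classical supersolution of `∂_t w = ∂_x² w + f(w)` on `(−∞,T] × [0,∞)`. -/
def IsSuperSol (f : ℝ → ℝ) (T : ℝ) (u : ℝ → ℝ → ℝ) : Prop :=
  ContinuousOn (fun p : ℝ × ℝ => u p.1 p.2) (Iic T ×ˢ Ici 0) ∧
  (∀ t, t ≤ T → ∀ x : ℝ, 0 ≤ x →
    DifferentiableAt ℝ (fun τ => u τ x) t ∧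
    DifferentiableAt ℝ (u t) x ∧
    DifferentiableAt ℝ (deriv (u t)) x) ∧
  ContinuousOn (fun p : ℝ × ℝ => deriv (fun τ => u τ p.2) p.1) (Iic T ×ˢ Ici 0) ∧
  ContinuousOn (fun p : ℝ × ℝ => deriv (u p.1) p.2) (Iic T ×ˢ Ici 0) ∧
  ContinuousOn (fun p : ℝ × ℝ => deriv (deriv (u p.1)) p.2) (Iic T ×ˢ Ici 0) ∧
  (∀ t, t ≤ T → ∀ x : ℝ, 0 ≤ x →
    deriv (deriv (u t)) x + f (u t x) ≤ deriv (fun τ => u τ x) t)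

/-- The part of a star graph consisting of the segment `[0, b]` of edge `i` and of all the other
edges. -/
def StarRegion {N : ℕ} (i : Fin N) (b : ℝ) (j : Fin N) (x : ℝ) : Prop :=
  (j = i ∧ 0 ≤ x ∧ x ≤ b) ∨ (j ≠ i ∧ 0 ≤ x)

lemma StarRegion.nonneg {N : ℕ} {i j : Fin N} {b x : ℝ} (h : StarRegion i b j x) : 0 ≤ x := by
  rcases h with h | h
  · exact h.2.1
  · exact h.2

lemma HasDerivAt.nonneg_of_eventually_right {g : ℝ → ℝ} {d x : ℝ} (hg : HasDerivAt g d x)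
    (hmin : ∀ᶠ y in 𝓝[>] x, g x ≤ g y) : 0 ≤ d := by
  have h := (hasDerivAt_iff_tendsto_slope.1 hg).mono_left
    (nhdsWithin_mono x (fun y (hy : x < y) => hy.ne') : 𝓝[>] x ≤ 𝓝[≠] x)
  refine ge_of_tendsto h ?_
  filter_upwards [hmin, self_mem_nhdsWithin] with y hy hxy
  rw [slope_def_field]
  exact div_nonneg (sub_nonneg.2 hy) (sub_nonneg.2 (le_of_lt hxy))

lemma HasDerivAt.nonpos_of_eventually_left {g : ℝ → ℝ} {d x : ℝ} (hg : HasDerivAt g d x)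
    (hmin : ∀ᶠ y in 𝓝[<] x, g x ≤ g y) : d ≤ 0 := by
  have h := (hasDerivAt_iff_tendsto_slope.1 hg).mono_left
    (nhdsWithin_mono x (fun y (hy : y < x) => hy.ne) : 𝓝[<] x ≤ 𝓝[≠] x)
  refine le_of_tendsto h ?_
  filter_upwards [hmin, self_mem_nhdsWithin] with y hy hxy
  rw [slope_def_field]
  exact div_nonpos_of_nonneg_of_nonpos (sub_nonneg.2 hy) (sub_nonpos.2 (le_of_lt hxy))

lemma second_deriv_nonneg_of_eventually_right {g g' : ℝ → ℝ} {d x : ℝ}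
    (hg : ∀ y, x ≤ y → HasDerivAt g (g' y) y) (hg' : HasDerivAt g' d x) (h0 : g' x = 0)
    (hmin : ∀ᶠ y in 𝓝[>] x, g x ≤ g y) : 0 ≤ d := by
  by_contra! hd
  have h := (hasDerivAt_iff_tendsto_slope.1 hg').mono_left
    (nhdsWithin_mono x (fun y (hy : x < y) => hy.ne') : 𝓝[>] x ≤ 𝓝[≠] x)
  have hneg : ∀ᶠ y in 𝓝[>] x, g' y < 0 := by
    filter_upwards [h.eventually_lt_const hd, self_mem_nhdsWithin] with y hy hxy
    rw [slope_def_field, h0, sub_zero] at hy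
    by_contra! hc
    exact absurd hy (not_lt.2 (div_nonneg hc (sub_nonneg.2 (le_of_lt hxy))))
  obtain ⟨e, he, hsub⟩ := (mem_nhdsGT_iff_exists_Ioc_subset).1 (hneg.and hmin)
  have he : x < e := he
  have hanti : StrictAntiOn g (Icc x e) := by
    refine strictAntiOn_of_deriv_neg (convex_Icc x e)
      (fun y hy => (hg y hy.1).continuousAt.continuousWithinAt) fun y hy => ?_
    rw [interior_Icc] at hy
    rw [(hg y hy.1.le).deriv]
    exact (hsub ⟨hy.1, hy.2.le⟩).1
  exact absurd (hanti (left_mem_Icc.2 he.le) (right_mem_Icc.2 he.le) he)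
    (not_lt.2 (hsub ⟨he, le_rfl⟩).2)

/-- Weak minimum principle on the part `0 ≤ x ≤ b t` of edge `i` and all other edges of a star
graph, for functions satisfying the super-Kirchhoff inequality at the junction and a strict
differential inequality wherever they are negative. -/
lemma star_minimum_principle {N : ℕ} {ρ : Fin N → ℝ} (hρ : ∀ j, 0 < ρ j) {i : Fin N}
    {z zt zx zxx : Fin N → ℝ → ℝ → ℝ} {s t₀ X : ℝ} {b : ℝ → ℝ} (hb : Continuous b)
    (hb0 : ∀ t ∈ Icc s t₀, 0 ≤ b t) (hbX : ∀ t ∈ Icc s t₀, b t ≤ X)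
    (hz : ∀ j, ContinuousOn (fun p : ℝ × ℝ => z j p.1 p.2) (Icc s t₀ ×ˢ Ici 0))
    (hzt : ∀ j, ∀ t ∈ Icc s t₀, ∀ x, 0 ≤ x → HasDerivAt (fun τ => z j τ x) (zt j t x) t)
    (hzx : ∀ j, ∀ t ∈ Icc s t₀, ∀ x, 0 ≤ x → HasDerivAt (z j t) (zx j t x) x)
    (hzxx : ∀ j, ∀ t ∈ Icc s t₀, ∀ x, 0 ≤ x → HasDerivAt (zx j t) (zxx j t x) x)
    (hjunc : ∀ t ∈ Icc s t₀, ∀ j k, z j t 0 = z k t 0)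
    (hK : ∀ t ∈ Icc s t₀, ∑ j, ρ j * zx j t 0 ≤ 0)
    (hinit : ∀ j x, StarRegion i (b s) j x → 0 ≤ z j s x)
    (hcurve : ∀ t ∈ Icc s t₀, 0 ≤ z i t (b t))
    (hfar : ∀ j, j ≠ i → ∀ t ∈ Icc s t₀, ∀ x, X ≤ x → 0 ≤ z j t x)
    (hpde : ∀ j, ∀ t ∈ Icc s t₀, ∀ x, StarRegion i (b t) j x → z j t x < 0 →
      zxx j t x < zt j t x) :
    ∀ j, ∀ t ∈ Icc s t₀, ∀ x, StarRegion i (b t) j x → 0 ≤ z j t x := by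
  intro j₁ t₁ ht₁ x₁ hR₁
  by_contra! hneg₁
  have hX0 : 0 ≤ X := (hb0 t₁ ht₁).trans (hbX t₁ ht₁)
  set R : Set (Fin N × ℝ × ℝ) :=
    (univ ×ˢ (Icc s t₀ ×ˢ Icc 0 X)) ∩ {p | p.1 = i → p.2.2 ≤ b p.2.1} with hRdef
  have memR : ∀ j t x, (j, t, x) ∈ R ↔
      t ∈ Icc s t₀ ∧ (0 ≤ x ∧ x ≤ X) ∧ (j = i → x ≤ b t) := by
    intro j t x
    simp only [hRdef, mem_inter_iff, mem_prod, mem_univ, true_and, mem_Icc,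
      mem_ofPred_eq, and_assoc]
  have regR : ∀ j t x, (j, t, x) ∈ R → StarRegion i (b t) j x := by
    intro j t x h
    obtain ⟨-, h1, h2⟩ := (memR j t x).1 h
    by_cases hj : j = i
    · exact Or.inl ⟨hj, h1.1, h2 hj⟩
    · exact Or.inr ⟨hj, h1.1⟩
  have hclosed : IsClosed {p : Fin N × ℝ × ℝ | p.1 = i → p.2.2 ≤ b p.2.1} := by
    have : {p : Fin N × ℝ × ℝ | p.1 = i → p.2.2 ≤ b p.2.1} =
        (Prod.fst ⁻¹' {i}ᶜ) ∪ {p | p.2.2 ≤ b p.2.1} := by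
      ext p
      simp [imp_iff_not_or]
    rw [this]
    exact ((isClosed_discrete _).preimage continuous_fst).union
      (isClosed_le (by fun_prop) (by fun_prop))
  have hcompact : IsCompact R :=
    (isCompact_univ.prod (isCompact_Icc.prod isCompact_Icc)).inter_right hclosed
  have hcont : ContinuousOn (fun p : Fin N × ℝ × ℝ => z p.1 p.2.1 p.2.2) R := by
    rw [continuousOn_prod_of_discrete_left]
    intro j
    refine (hz j).mono fun p hp => ?_
    obtain ⟨h1, h2, -⟩ := (memR j p.1 p.2).1 hp
    exact ⟨h1, h2.1⟩
  have hmem₁ : (j₁, t₁, x₁) ∈ R := by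
    refine (memR _ _ _).2 ⟨ht₁, ⟨hR₁.nonneg, ?_⟩, ?_⟩
    · rcases hR₁ with h | h
      · exact h.2.2.trans (hbX t₁ ht₁)
      · by_contra! hc
        exact absurd (hfar j₁ h.1 t₁ ht₁ x₁ hc.le) (not_le.2 hneg₁)
    · intro hj
      rcases hR₁ with h | h
      · exact h.2.2
      · exact absurd hj h.1
  obtain ⟨⟨j, t, x⟩, hp, hmin⟩ := hcompact.exists_isMinOn ⟨_, hmem₁⟩ hcont
  have hneg : z j t x < 0 := lt_of_le_of_lt (hmin hmem₁) hneg₁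
  have hmin : ∀ k τ y, (k, τ, y) ∈ R → z j t x ≤ z k τ y := fun k τ y h => hmin h
  obtain ⟨ht, ⟨hx0, hxX⟩, hxb⟩ := (memR j t x).1 hp
  have hst : s < t := by
    refine lt_of_le_of_ne ht.1 ?_
    rintro rfl
    exact absurd (hinit j x (regR _ _ _ hp)) (not_le.2 hneg)
  have hpast : ∀ᶠ τ in 𝓝[<] t, τ ∈ Icc s t₀ := by
    filter_upwards [Ioo_mem_nhdsLT hst] with τ hτ
    exact ⟨hτ.1.le, hτ.2.le.trans ht.2⟩
  rcases hx0.eq_or_lt with rfl | hxpos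
  · have hval : ∀ k, z k t 0 = z j t 0 := fun k => hjunc t ht k j
    have hbt : 0 < b t := by
      refine lt_of_le_of_ne (hb0 t ht) fun h => ?_
      have := hcurve t ht
      rw [← h, hval i] at this
      exact absurd this (not_le.2 hneg)
    have hright : ∀ k, ∀ᶠ y in 𝓝[>] (0 : ℝ), z k t 0 ≤ z k t y := by
      intro k
      filter_upwards [Ioo_mem_nhdsGT hbt] with y hy
      rw [hval k]
      exact hmin _ _ _ ((memR _ _ _).2
        ⟨ht, ⟨hy.1.le, hy.2.le.trans (hbX t ht)⟩, fun _ => hy.2.le⟩)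
    have hnn : ∀ k, 0 ≤ zx k t 0 := fun k =>
      (hzx k t ht 0 le_rfl).nonneg_of_eventually_right (hright k)
    have hzero : zx i t 0 = 0 := by
      have h1 : ρ i * zx i t 0 ≤ ∑ k, ρ k * zx k t 0 :=
        Finset.single_le_sum (f := fun k => ρ k * zx k t 0)
          (fun k _ => mul_nonneg (hρ k).le (hnn k)) (Finset.mem_univ i)
      have h2 := h1.trans (hK t ht)
      exact le_antisymm (nonpos_of_mul_nonpos_right h2 (hρ i)) (hnn i)
    have h2 := second_deriv_nonneg_of_eventually_right (fun y hy => hzx i t ht y hy)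
      (hzxx i t ht 0 le_rfl) hzero (hright i)
    have h3 : zt i t 0 ≤ 0 := by
      refine (hzt i t ht 0 le_rfl).nonpos_of_eventually_left ?_
      filter_upwards [hpast] with τ hτ
      rw [hval i]
      exact hmin _ _ _ ((memR _ _ _).2 ⟨hτ, ⟨le_rfl, hX0⟩, fun _ => hb0 τ hτ⟩)
    have h4 := hpde i t ht 0 (Or.inl ⟨rfl, le_rfl, hbt.le⟩) (by rwa [hval i])
    linarith
  · have hbx : j = i → x < b t := by
      intro hj
      refine lt_of_le_of_ne (hxb hj) fun h => ?_
      have := hcurve t ht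
      rw [← h, ← hj] at this
      exact absurd this (not_le.2 hneg)
    have hltX : x < X := by
      by_cases hj : j = i
      · exact (hbx hj).trans_le (hbX t ht)
      · by_contra! hc
        exact absurd (hfar j hj t ht x hc) (not_le.2 hneg)
    have hnear : ∀ᶠ y in 𝓝 x, z j t x ≤ z j t y := by
      have hev : ∀ᶠ y in 𝓝 x, j = i → y < b t := by
        by_cases hj : j = i
        · filter_upwards [Iio_mem_nhds (hbx hj)] with y hy _ using hy
        · exact Eventually.of_forall fun y h => absurd h hj
      filter_upwards [Ioo_mem_nhds hxpos hltX, hev] with y hy hy'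
      exact hmin _ _ _ ((memR _ _ _).2 ⟨ht, ⟨hy.1.le, hy.2.le⟩, fun h => (hy' h).le⟩)
    have h1 : zx j t x = 0 := IsLocalMin.hasDerivAt_eq_zero hnear (hzx j t ht x hx0)
    have h2 := second_deriv_nonneg_of_eventually_right
      (fun y hy => hzx j t ht y (hx0.trans hy)) (hzxx j t ht x hx0) h1
      (hnear.filter_mono nhdsWithin_le_nhds)
    have h3 : zt j t x ≤ 0 := by
      refine (hzt j t ht x hx0).nonpos_of_eventually_left ?_
      have hev : ∀ᶠ τ in 𝓝[<] t, j = i → x < b τ := by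
        by_cases hj : j = i
        · filter_upwards [(hb.continuousAt.eventually_const_lt (hbx hj)).filter_mono
            nhdsWithin_le_nhds] with τ hτ _ using hτ
        · exact Eventually.of_forall fun y h => absurd h hj
      filter_upwards [hpast, hev] with τ hτ hτ'
      exact hmin _ _ _ ((memR _ _ _).2 ⟨hτ, ⟨hx0, hxX⟩, fun h => (hτ' h).le⟩)
    have h4 := hpde j t ht x (regR _ _ _ hp) hneg
    linarith

/-- A strict lower barrier for the difference of a super- and a subsolution on a star graph that
lies below it on the parabolic boundary lies below it everywhere. -/
lemma star_barrier_le {f : ℝ → ℝ} {T : ℝ} {N : ℕ} {ρ : Fin N → ℝ} (hρ : ∀ j, 0 < ρ j)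
    {i : Fin N} {u w : Fin N → ℝ → ℝ → ℝ}
    (hu : ∀ j, IsSubSol f T (u j)) (hw : ∀ j, IsSuperSol f T (w j))
    (hujunc : ∀ t, t ≤ T → ∀ j k, u j t 0 = u k t 0)
    (huK : ∀ t, t ≤ T → 0 ≤ ∑ j, ρ j * derivWithin (u j t) (Ici 0) 0)
    (hwjunc : ∀ t, t ≤ T → ∀ j k, w j t 0 = w k t 0)
    (hwK : ∀ t, t ≤ T → (∑ j, ρ j * derivWithin (w j t) (Ici 0) 0) ≤ 0)
    {b : ℝ → ℝ} (hb : Continuous b) (hb0 : ∀ t, t ≤ T → 0 ≤ b t)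
    {φ φt φx φxx : Fin N → ℝ → ℝ → ℝ} {s t₀ X : ℝ} (ht₀ : t₀ ≤ T)
    (hbX : ∀ t ∈ Icc s t₀, b t ≤ X)
    (hφ : ∀ j, Continuous (fun p : ℝ × ℝ => φ j p.1 p.2))
    (hφt : ∀ j t x, HasDerivAt (fun τ => φ j τ x) (φt j t x) t)
    (hφx : ∀ j t x, HasDerivAt (φ j t) (φx j t x) x)
    (hφxx : ∀ j t x, HasDerivAt (φx j t) (φxx j t x) x)
    (hφjunc : ∀ t j k, φ j t 0 = φ k t 0)
    (hφK : ∀ t, 0 ≤ ∑ j, ρ j * φx j t 0)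
    (hinit : ∀ j x, StarRegion i (b s) j x → φ j s x ≤ w j s x - u j s x)
    (hcurve : ∀ t ∈ Icc s t₀, φ i t (b t) ≤ w i t (b t) - u i t (b t))
    (hfar : ∀ j, j ≠ i → ∀ t ∈ Icc s t₀, ∀ x, X ≤ x → φ j t x ≤ w j t x - u j t x)
    (hpde : ∀ j, ∀ t ∈ Icc s t₀, ∀ x, StarRegion i (b t) j x → w j t x - u j t x < φ j t x →
      φt j t x - φxx j t x < f (w j t x) - f (u j t x)) :
    ∀ j, ∀ t ∈ Icc s t₀, ∀ x, StarRegion i (b t) j x → φ j t x ≤ w j t x - u j t x := by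
  have hT : ∀ {t}, t ∈ Icc s t₀ → t ≤ T := fun ht => ht.2.trans ht₀
  have hsub : Icc s t₀ ×ˢ Ici (0 : ℝ) ⊆ Iic T ×ˢ Ici 0 :=
    prod_mono (fun t ht => hT ht) Subset.rfl
  have key := star_minimum_principle (ρ := ρ) hρ (i := i) (s := s) (t₀ := t₀) (X := X) (b := b)
    (z := fun j t x => w j t x - u j t x - φ j t x)
    (zt := fun j t x => deriv (fun τ => w j τ x) t - deriv (fun τ => u j τ x) t - φt j t x)
    (zx := fun j t x => deriv (w j t) x - deriv (u j t) x - φx j t x)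
    (zxx := fun j t x => deriv (deriv (w j t)) x - deriv (deriv (u j t)) x - φxx j t x)
    hb (fun t ht => hb0 t (hT ht)) hbX
    (fun j => (((hw j).1.mono hsub).sub ((hu j).1.mono hsub)).sub (hφ j).continuousOn)
    (fun j t ht x hx => (((hw j).2.1 t (hT ht) x hx).1.hasDerivAt.sub
      ((hu j).2.1 t (hT ht) x hx).1.hasDerivAt).sub (hφt j t x))
    (fun j t ht x hx => (((hw j).2.1 t (hT ht) x hx).2.1.hasDerivAt.sub
      ((hu j).2.1 t (hT ht) x hx).2.1.hasDerivAt).sub (hφx j t x))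
    (fun j t ht x hx => (((hw j).2.1 t (hT ht) x hx).2.2.hasDerivAt.sub
      ((hu j).2.1 t (hT ht) x hx).2.2.hasDerivAt).sub (hφxx j t x))
    (fun t ht j k => by
      simp only [hujunc t (hT ht) j k, hwjunc t (hT ht) j k, hφjunc t j k])
    (fun t ht => by
      have h1 : ∑ j, ρ j * derivWithin (u j t) (Ici 0) 0 = ∑ j, ρ j * deriv (u j t) 0 :=
        Finset.sum_congr rfl fun j _ => by
          rw [((hu j).2.1 t (hT ht) 0 le_rfl).2.1.derivWithin
            (uniqueDiffOn_Ici 0 0 self_mem_Ici)]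
      have h2 : ∑ j, ρ j * derivWithin (w j t) (Ici 0) 0 = ∑ j, ρ j * deriv (w j t) 0 :=
        Finset.sum_congr rfl fun j _ => by
          rw [((hw j).2.1 t (hT ht) 0 le_rfl).2.1.derivWithin
            (uniqueDiffOn_Ici 0 0 self_mem_Ici)]
      have h3 := huK t (hT ht)
      have h4 := hwK t (hT ht)
      have h5 := hφK t
      rw [h1] at h3
      rw [h2] at h4
      simp only [mul_sub, Finset.sum_sub_distrib]
      linarith)
    (fun j x h => sub_nonneg.2 (hinit j x h))
    (fun t ht => sub_nonneg.2 (hcurve t ht))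
    (fun j hj t ht x hx => sub_nonneg.2 (hfar j hj t ht x hx))
    (fun j t ht x hR hneg => by
      have h1 := hpde j t ht x hR (sub_neg.1 hneg)
      have h2 := (hu j).2.2.2.2.2 t (hT ht) x hR.nonneg
      have h3 := (hw j).2.2.2.2.2 t (hT ht) x hR.nonneg
      linarith)
  exact fun j t ht x hR => sub_nonneg.1 (key j t ht x hR)

/-- Weak comparison for ancient sub- and supersolutions: the linear damping on `[0, δ₀]` drives the
negative part of the difference to zero. -/
lemma ancient_star_comparison_le {f : ℝ → ℝ} {δ₀ σ₀ : ℝ} (hf : ContDiff ℝ 1 f)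
    (hσ₀ : 0 < σ₀) (hfδ : ∀ s ∈ Icc 0 δ₀, deriv f s ≤ -σ₀)
    {T : ℝ} {N : ℕ} {ρ : Fin N → ℝ} (hρ : ∀ j, 0 < ρ j) {i : Fin N}
    {u w : Fin N → ℝ → ℝ → ℝ}
    (hu : ∀ j, IsSubSol f T (u j)) (hw : ∀ j, IsSuperSol f T (w j))
    (hwbd : ∀ j, ∀ t, t ≤ T → ∀ x : ℝ, 0 ≤ x → 0 ≤ w j t x)
    (hujunc : ∀ t, t ≤ T → ∀ j k, u j t 0 = u k t 0)
    (huK : ∀ t, t ≤ T → 0 ≤ ∑ j, ρ j * derivWithin (u j t) (Ici 0) 0)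
    (hwjunc : ∀ t, t ≤ T → ∀ j k, w j t 0 = w k t 0)
    (hwK : ∀ t, t ≤ T → (∑ j, ρ j * derivWithin (w j t) (Ici 0) 0) ≤ 0)
    {b : ℝ → ℝ} (hb : Continuous b) (hb0 : ∀ t, t ≤ T → 0 ≤ b t)
    (hcurve : ∀ t, t ≤ T → u i t (b t) ≤ w i t (b t))
    (hband : ∀ j, ∀ t, t ≤ T → ∀ x : ℝ, StarRegion i (b t) j x → 0 ≤ u j t x ∧ u j t x ≤ δ₀)
    (j : Fin N) {t : ℝ} (ht : t ≤ T) {x : ℝ} (hR : StarRegion i (b t) j x) :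
    u j t x ≤ w j t x := by
  have hδ₀ : 0 ≤ δ₀ := (hband j t ht x hR).1.trans (hband j t ht x hR).2
  have hmvt : ∀ p q, 0 ≤ p → p ≤ q → q ≤ δ₀ → f q - f p ≤ -σ₀ * (q - p) := by
    intro p q hp hpq hq
    refine (convex_Icc 0 δ₀).image_sub_le_mul_sub_of_deriv_le hf.continuous.continuousOn
      (hf.differentiable one_ne_zero).differentiableOn
      (fun y hy => hfδ y (interior_subset hy)) p ⟨hp, hpq.trans hq⟩ q ⟨hp.trans hpq, hq⟩ hpq
  have main : ∀ s ≤ t, ∀ μ > 0,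
      -(δ₀ * Real.exp (-σ₀ * (t - s)) + μ * (1 + σ₀ / 2 * x ^ 2)) ≤ w j t x - u j t x := by
    intro s hs μ hμ
    obtain ⟨B, hB⟩ := isCompact_Icc.bddAbove_image (f := b) (K := Icc s t) hb.continuousOn
    set X := max B (max 1 (δ₀ / (μ * (σ₀ / 2)))) with hXdef
    have hX1 : 1 ≤ X := (le_max_left _ _).trans (le_max_right _ _)
    have hX2 : δ₀ ≤ μ * (σ₀ / 2) * X := by
      have : δ₀ / (μ * (σ₀ / 2)) ≤ X := (le_max_right _ _).trans (le_max_right _ _)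
      rwa [div_le_iff₀' (by positivity)] at this
    refine star_barrier_le hρ hu hw hujunc huK hwjunc hwK hb hb0 (s := s) (t₀ := t) (X := X)
      (φ := fun _ t x => -(δ₀ * Real.exp (-σ₀ * (t - s)) + μ * (1 + σ₀ / 2 * x ^ 2)))
      (φt := fun _ t _ => σ₀ * (δ₀ * Real.exp (-σ₀ * (t - s))))
      (φx := fun _ _ x => -(μ * σ₀ * x)) (φxx := fun _ _ _ => -(μ * σ₀)) ht
      (fun τ hτ => (hB (mem_image_of_mem b hτ)).trans (le_max_left _ _))
      (fun _ => by fun_prop) ?_ ?_ ?_ (fun _ _ _ => rfl) (fun _ => by simp)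
      ?_ ?_ ?_ ?_ j t ⟨hs, le_rfl⟩ x hR
    · intro _ τ y
      have h1 : HasDerivAt (fun τ => -σ₀ * (τ - s)) (-σ₀ * 1) τ :=
        ((hasDerivAt_id τ).sub_const s).const_mul (-σ₀)
      refine HasDerivAt.congr_deriv (((h1.exp.const_mul δ₀).add_const (μ * (1 + σ₀ / 2 * y ^ 2))).neg) ?_
      ring
    · intro _ τ y
      have h1 : HasDerivAt (fun y : ℝ => μ * (1 + σ₀ / 2 * y ^ 2))
          (μ * (σ₀ / 2 * (2 * y))) y := by
        have := (((hasDerivAt_pow 2 y).const_mul (σ₀ / 2)).const_add 1).const_mul μ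
        simpa using this
      refine HasDerivAt.congr_deriv ((h1.const_add (δ₀ * Real.exp (-σ₀ * (τ - s)))).neg) ?_
      ring
    · intro _ τ y
      exact (((hasDerivAt_id y).const_mul (μ * σ₀)).neg).congr_deriv (by rw [mul_one])
    · intro k y hRk
      have h1 := (hband k s (hs.trans ht) y hRk).2
      have h2 := hwbd k s (hs.trans ht) y hRk.nonneg
      have h3 : 0 ≤ μ * (1 + σ₀ / 2 * y ^ 2) := by positivity
      simp only [sub_self, mul_zero, Real.exp_zero, mul_one]
      linarith
    · intro τ hτ
      have h1 := hcurve τ (hτ.2.trans ht)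
      have h2 : 0 ≤ δ₀ * Real.exp (-σ₀ * (τ - s)) + μ * (1 + σ₀ / 2 * b τ ^ 2) := by positivity
      linarith
    · intro k hk τ hτ y hy
      have hy0 : 0 ≤ y := by linarith
      have h1 := (hband k τ (hτ.2.trans ht) y (Or.inr ⟨hk, hy0⟩)).2
      have h2 := hwbd k τ (hτ.2.trans ht) y hy0
      have h3 : 0 ≤ δ₀ * Real.exp (-σ₀ * (τ - s)) := by positivity
      have h4 : δ₀ ≤ μ * (σ₀ / 2) * y ^ 2 := by
        refine hX2.trans (mul_le_mul_of_nonneg_left ?_ (by positivity))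
        nlinarith
      nlinarith
    · intro k τ hτ y hRk hlt
      have h0 := hband k τ (hτ.2.trans ht) y hRk
      have h2 := hwbd k τ (hτ.2.trans ht) y hRk.nonneg
      have h3 : 0 ≤ δ₀ * Real.exp (-σ₀ * (τ - s)) := by positivity
      have h4 : 0 ≤ μ * (1 + σ₀ / 2 * y ^ 2) := by positivity
      have h5 := hmvt (w k τ y) (u k τ y) h2 (by linarith) h0.2
      have h6 := mul_lt_mul_of_pos_left hlt hσ₀
      have h7 : 0 ≤ μ * σ₀ * (σ₀ * y ^ 2) := by positivity
      nlinarith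
  have hlim : Tendsto (fun n : ℕ => -(δ₀ * Real.exp (-σ₀ * (t - (t - n)))
      + 1 / ((n : ℝ) + 1) * (1 + σ₀ / 2 * x ^ 2))) atTop (𝓝 (-(δ₀ * 0
      + 0 * (1 + σ₀ / 2 * x ^ 2)))) := by
    refine (((Real.tendsto_exp_atBot.comp ?_).const_mul δ₀).add
      (tendsto_one_div_add_atTop_nhds_zero_nat.mul_const _)).neg
    simp only [sub_sub_cancel]
    exact tendsto_natCast_atTop_atTop.const_mul_atTop_of_neg (neg_lt_zero.2 hσ₀)
  have h := le_of_tendsto' hlim fun n : ℕ =>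
    main (t - n) (sub_le_self t n.cast_nonneg) _ Nat.one_div_pos_of_nat
  simp only [mul_zero, zero_mul, add_zero, neg_zero] at h
  linarith

/-- Strict comparison from weak comparison: an exponential profile travelling away from `x = b t`
is a positive lower barrier for the difference. -/
lemma star_comparison_lt_of_le {f : ℝ → ℝ} (hf : ContDiff ℝ 1 f)
    {T : ℝ} {N : ℕ} (hN : 2 ≤ N) {ρ : Fin N → ℝ} (hρ : ∀ j, 0 < ρ j) {i : Fin N}
    {u w : Fin N → ℝ → ℝ → ℝ}
    (hu : ∀ j, IsSubSol f T (u j)) (hw : ∀ j, IsSuperSol f T (w j))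
    (hubd : ∀ j, ∀ t, t ≤ T → ∀ x : ℝ, 0 ≤ x → 0 ≤ u j t x ∧ u j t x ≤ 1)
    (hwbd : ∀ j, ∀ t, t ≤ T → ∀ x : ℝ, 0 ≤ x → 0 ≤ w j t x ∧ w j t x ≤ 1)
    (hujunc : ∀ t, t ≤ T → ∀ j k, u j t 0 = u k t 0)
    (huK : ∀ t, t ≤ T → 0 ≤ ∑ j, ρ j * derivWithin (u j t) (Ici 0) 0)
    (hwjunc : ∀ t, t ≤ T → ∀ j k, w j t 0 = w k t 0)
    (hwK : ∀ t, t ≤ T → (∑ j, ρ j * derivWithin (w j t) (Ici 0) 0) ≤ 0)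
    {b : ℝ → ℝ} (hb : Continuous b) (hb0 : ∀ t, t ≤ T → 0 ≤ b t)
    (hcurve : ∀ t, t ≤ T → u i t (b t) < w i t (b t))
    (hle : ∀ j, ∀ t, t ≤ T → ∀ x : ℝ, StarRegion i (b t) j x → u j t x ≤ w j t x)
    (j : Fin N) {t : ℝ} (ht : t ≤ T) {x : ℝ} (hR : StarRegion i (b t) j x) :
    u j t x < w j t x := by
  have hx0 := hR.nonneg
  obtain ⟨L, hL⟩ := isCompact_Icc.exists_bound_of_continuousOn (s := Icc (0 : ℝ) 1)
    (hf.continuous_deriv le_rfl).continuousOn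
  have hL0 : 0 ≤ L := (norm_nonneg _).trans (hL 0 ⟨le_rfl, zero_le_one⟩)
  have hlip : ∀ p ∈ Icc (0 : ℝ) 1, ∀ q ∈ Icc (0 : ℝ) 1, |f q - f p| ≤ L * |q - p| :=
    fun p hp q hq => (convex_Icc (0 : ℝ) 1).norm_image_sub_le_of_norm_deriv_le
      (fun y _ => hf.differentiable one_ne_zero y) hL hp hq
  set s := t - 1 with hs
  have hst : s ≤ t := by linarith
  obtain ⟨B, hB⟩ := isCompact_Icc.bddAbove_image (f := b) (K := Icc s t) hb.continuousOn
  have hB : ∀ τ ∈ Icc s t, b τ ≤ B := fun τ hτ => hB (mem_image_of_mem b hτ)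
  have hB0 : 0 ≤ B := (hb0 t ht).trans (hB t ⟨hst, le_rfl⟩)
  obtain ⟨ε, hε, hεle⟩ : ∃ ε > 0, ∀ τ ∈ Icc s t, ε ≤ w i τ (b τ) - u i τ (b τ) := by
    have hmaps : MapsTo (fun τ => (τ, b τ)) (Icc s t) (Iic T ×ˢ Ici 0) :=
      fun τ hτ => ⟨hτ.2.trans ht, hb0 τ (hτ.2.trans ht)⟩
    have hc : ContinuousOn (fun τ => w i τ (b τ) - u i τ (b τ)) (Icc s t) :=
      ((hw i).1.comp (continuous_id.prodMk hb).continuousOn hmaps).sub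
        ((hu i).1.comp (continuous_id.prodMk hb).continuousOn hmaps)
    obtain ⟨τ, hτ, hmin⟩ := isCompact_Icc.exists_isMinOn ⟨t, hst, le_rfl⟩ hc
    exact ⟨_, sub_pos.2 (hcurve τ (hτ.2.trans ht)), fun τ' hτ' => hmin hτ'⟩
  set S := ∑ k ∈ Finset.univ.erase i, ρ k with hS
  have hSpos : 0 < S := by
    refine Finset.sum_pos (fun k _ => hρ k) ?_
    rw [← Finset.card_pos, Finset.card_erase_of_mem (Finset.mem_univ i), Finset.card_univ,
      Fintype.card_fin]
    omega
  set κ := ρ i / S with hκ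
  have hκpos : 0 < κ := div_pos (hρ i) hSpos
  set c : Fin N → ℝ := fun k => if k = i then 1 else -κ with hc
  have hci : c i = 1 := by simp [hc]
  have hcne : ∀ k, k ≠ i → c k = -κ := fun k hk => by simp [hc, hk]
  have hcsum : ∑ k, ρ k * c k = 0 := by
    rw [← Finset.add_sum_erase _ _ (Finset.mem_univ i), hci,
      Finset.sum_congr rfl fun k hk => by rw [hcne k (Finset.ne_of_mem_erase hk)],
      ← Finset.sum_mul, ← hS, hκ]
    field_simp
    ring
  have hcge : ∀ k, -κ ≤ c k := fun k => by
    by_cases hk : k = i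
    · rw [hk, hci]; linarith
    · rw [hcne k hk]
  set q := min 1 (κ ^ 2) with hq
  have hqpos : 0 < q := lt_min one_pos (by positivity)
  have hcq : ∀ k, q ≤ c k ^ 2 := fun k => by
    by_cases hk : k = i
    · rw [hk, hci, one_pow]; exact min_le_left _ _
    · rw [hcne k hk, neg_sq]; exact min_le_right _ _
  set m := B + κ * x + 1 with hm
  have hmpos : 0 < m := by positivity
  obtain ⟨l, hl1, hl⟩ : ∃ l : ℝ, 1 ≤ l ∧ l * m + L < l ^ 2 * q := by
    refine ⟨(m + L + 1) / q + 1, by simp only [le_add_iff_nonneg_left]; positivity, ?_⟩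
    set l := (m + L + 1) / q + 1
    have h1 : 1 ≤ l := by simp only [l, le_add_iff_nonneg_left]; positivity
    have h2 : m + L + 1 ≤ l * q := by
      simp only [l, add_mul, div_mul_cancel₀ _ hqpos.ne']
      linarith
    nlinarith
  have hlpos : 0 < l := by linarith
  set η := ε / Real.exp (l * m) with hη
  have hηpos : 0 < η := div_pos hε (Real.exp_pos _)
  have hηm : η * Real.exp (l * m) = ε := div_mul_cancel₀ _ (Real.exp_pos _).ne'
  have hnonpos : ∀ ξ, ξ ≤ 0 → η * (Real.exp (l * ξ) - 1) ≤ 0 := fun ξ hξ =>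
    mul_nonpos_of_nonneg_of_nonpos hηpos.le
      (sub_nonpos.2 (Real.exp_le_one_iff.2 (mul_nonpos_of_nonneg_of_nonpos hlpos.le hξ)))
  have key := star_barrier_le hρ hu hw hujunc huK hwjunc hwK hb hb0 (s := s) (t₀ := t)
      (X := max B (m / κ)) (i := i)
      (φ := fun k τ y => η * (Real.exp (l * (c k * y - B + m * (τ - s))) - 1))
      (φt := fun k τ y => η * (l * m) * Real.exp (l * (c k * y - B + m * (τ - s))))
      (φx := fun k τ y => η * (l * c k) * Real.exp (l * (c k * y - B + m * (τ - s))))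
      (φxx := fun k τ y => η * (l * c k) ^ 2 * Real.exp (l * (c k * y - B + m * (τ - s))))
      ht (fun τ hτ => (hB τ hτ).trans (le_max_left _ _)) (fun _ => by fun_prop)
      ?_ ?_ ?_ (fun _ _ _ => by simp) ?_ ?_ ?_ ?_ ?_ j t ⟨hst, le_rfl⟩ x hR
  · have hpos : 0 < η * (Real.exp (l * (c j * x - B + m * (t - s))) - 1) := by
      refine mul_pos hηpos (sub_pos.2 (Real.one_lt_exp_iff.2 (mul_pos hlpos ?_)))
      have := mul_le_mul_of_nonneg_right (hcge j) hx0
      simp only [hs, sub_sub_cancel, mul_one, hm]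
      linarith
    linarith
  · intro k τ y
    have h1 : HasDerivAt (fun τ => l * (c k * y - B + m * (τ - s))) (l * (m * 1)) τ :=
      ((((hasDerivAt_id τ).sub_const s).const_mul m).const_add (c k * y - B)).const_mul l
    refine HasDerivAt.congr_deriv ((h1.exp.sub_const 1).const_mul η) ?_
    ring
  · intro k τ y
    have h1 : HasDerivAt (fun y => l * (c k * y - B + m * (τ - s))) (l * (c k * 1)) y :=
      ((((hasDerivAt_id y).const_mul (c k)).sub_const B).add_const (m * (τ - s))).const_mul l
    refine HasDerivAt.congr_deriv ((h1.exp.sub_const 1).const_mul η) ?_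
    ring
  · intro k τ y
    have h1 : HasDerivAt (fun y => l * (c k * y - B + m * (τ - s))) (l * (c k * 1)) y :=
      ((((hasDerivAt_id y).const_mul (c k)).sub_const B).add_const (m * (τ - s))).const_mul l
    refine HasDerivAt.congr_deriv (h1.exp.const_mul (η * (l * c k))) ?_
    ring
  · intro τ
    have : ∑ k, ρ k * (η * (l * c k) * Real.exp (l * (c k * 0 - B + m * (τ - s)))) =
        (∑ k, ρ k * c k) * (η * l * Real.exp (l * (-B + m * (τ - s)))) := by
      rw [Finset.sum_mul]
      refine Finset.sum_congr rfl fun k _ => ?_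
      rw [mul_zero, zero_sub]
      ring
    rw [this, hcsum, zero_mul]
  · intro k y hRk
    refine (hnonpos _ ?_).trans (sub_nonneg.2 (hle k s (hst.trans ht) y hRk))
    have hcy : c k * y ≤ B := by
      rcases hRk with ⟨hk, -, hy⟩ | ⟨hk, hy⟩
      · rw [hk, hci, one_mul]
        exact hy.trans (hB s ⟨le_rfl, hst⟩)
      · rw [hcne k hk]
        nlinarith
    simp only [sub_self, mul_zero]
    linarith
  · intro τ hτ
    refine le_trans ?_ (hεle τ hτ)
    have h1 : l * (c i * b τ - B + m * (τ - s)) ≤ l * m := by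
      refine mul_le_mul_of_nonneg_left ?_ hlpos.le
      have h2 := hB τ hτ
      have h3 : m * (τ - s) ≤ m * 1 :=
        mul_le_mul_of_nonneg_left (by linarith [hτ.2]) hmpos.le
      rw [hci]
      linarith
    have h4 := mul_le_mul_of_nonneg_left (Real.exp_le_exp.2 h1) hηpos.le
    linarith
  · intro k hk τ hτ y hy
    have hy1 : m ≤ κ * y := (div_le_iff₀' hκpos).1 ((le_max_right _ _).trans hy)
    have hy0 : 0 ≤ y := hB0.trans ((le_max_left _ _).trans hy)
    refine (hnonpos _ ?_).trans (sub_nonneg.2 (hle k τ (hτ.2.trans ht) y (Or.inr ⟨hk, hy0⟩)))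
    have h3 : m * (τ - s) ≤ m * 1 :=
      mul_le_mul_of_nonneg_left (by linarith [hτ.2]) hmpos.le
    rw [hcne k hk]
    linarith
  · intro k τ hτ y hRk hlt
    have hτT := hτ.2.trans ht
    have h1 := hle k τ hτT y hRk
    have h2 := hlip _ (hubd k τ hτT y hRk.nonneg) _ (hwbd k τ hτT y hRk.nonneg)
    rw [abs_of_nonneg (sub_nonneg.2 h1)] at h2
    have h3 := neg_le_of_abs_le h2
    set E := Real.exp (l * (c k * y - B + m * (τ - s)))
    have hE : 0 < E := Real.exp_pos _
    have h4 := mul_le_mul_of_nonneg_left hlt.le hL0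
    have h5 : l ^ 2 * q ≤ (l * c k) ^ 2 := by
      rw [mul_pow]
      exact mul_le_mul_of_nonneg_left (hcq k) (by positivity)
    have h6 : (l * m + L) * (η * E) < (l * c k) ^ 2 * (η * E) :=
      mul_lt_mul_of_pos_right (hl.trans_le h5) (by positivity)
    have h7 : 0 ≤ L * η := by positivity
    linarith

/-- Comparison of ancient sub/supersolutions on a star graph (Lemma 4.3):
if the subsolution is ≤ δ₀ on `Ω_i[b(t)]` and on all other edges, and is
dominated by the supersolution at `x = b(t)` on edge `i`, then it is dominated
on that whole region. -/
theorem comparison_ancient_star (f : ℝ → ℝ) (a δ₀ σ₀ : ℝ) (hf : Bistable f a)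
    (hδ₀ : 0 < δ₀ ∧ δ₀ < 1/2) (hσ₀ : 0 < σ₀)
    (hfδ : ∀ s : ℝ, s ∈ Icc 0 δ₀ ∪ Icc (1 - δ₀) 1 → deriv f s ≤ -σ₀)
    (T : ℝ) (N : ℕ) (hN : 2 ≤ N) (ρ : Fin N → ℝ) (hρ : ∀ j, 0 < ρ j) (i : Fin N)
    (u w : Fin N → ℝ → ℝ → ℝ)
    (hu : ∀ j, IsSubSol f T (u j)) (hw : ∀ j, IsSuperSol f T (w j))
    (hubd : ∀ j, ∀ t, t ≤ T → ∀ x : ℝ, 0 ≤ x → 0 ≤ u j t x ∧ u j t x ≤ 1)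
    (hwbd : ∀ j, ∀ t, t ≤ T → ∀ x : ℝ, 0 ≤ x → 0 ≤ w j t x ∧ w j t x ≤ 1)
    (hujunc : ∀ t, t ≤ T → ∀ j k, u j t 0 = u k t 0)
    (huK : ∀ t, t ≤ T → 0 ≤ ∑ j, ρ j * derivWithin (u j t) (Ici 0) 0)
    (hwjunc : ∀ t, t ≤ T → ∀ j k, w j t 0 = w k t 0)
    (hwK : ∀ t, t ≤ T → (∑ j, ρ j * derivWithin (w j t) (Ici 0) 0) ≤ 0)
    (b : ℝ → ℝ) (hb : ContDiff ℝ (⊤ : ℕ∞) b) (hb0 : ∀ t, t ≤ T → 0 ≤ b t)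
    (hcurve : ∀ t, t ≤ T → u i t (b t) < w i t (b t))
    (hband : ∀ j, ∀ t, t ≤ T → ∀ x : ℝ,
      ((j = i ∧ 0 ≤ x ∧ x ≤ b t) ∨ (j ≠ i ∧ 0 ≤ x)) →
      0 ≤ u j t x ∧ u j t x ≤ δ₀) :
    ∀ j, ∀ t, t ≤ T → ∀ x : ℝ,
      ((j = i ∧ 0 ≤ x ∧ x ≤ b t) ∨ (j ≠ i ∧ 0 ≤ x)) →
      u j t x < w j t x := by
  have hle := fun j t (ht : t ≤ T) x (hR : StarRegion i (b t) j x) =>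
    ancient_star_comparison_le hf.1 hσ₀ (fun s hs => hfδ s (Or.inl hs)) hρ hu hw
      (fun j t ht x hx => (hwbd j t ht x hx).1) hujunc huK hwjunc hwK hb.continuous hb0
      (fun t ht => (hcurve t ht).le) hband j ht hR
  exact fun j t ht x hR => star_comparison_lt_of_le hf.1 hN hρ hu hw hubd hwbd hujunc huK hwjunc
    hwK hb.continuous hb0 hcurve hle j ht hR
end

section
/- Let 0 < d₁ ≤ d₂. Call u : ℝ → ℝ an admissible stationary profile if u is continuous on ℝ, twice continuously differentiable on (−∞,0) and on (0,∞) with 0 < u(x) < 1 for all x, satisfies d₁·u''(x) + f(u(x)) = 0 for x < 0 and d₂·u''(x) + f(u(x)) = 0 for x > 0, and its one-sided derivatives at 0 exist and satisfy d₁·u'(0⁻) = d₂·u'(0⁺). Then: (i) there is no admissible stationary profile with u(x) → 1 as x → +∞ and u(x) → 0 as x → −∞; (ii) an admissible stationary profile with u(x) → 1 as x → −∞ and u(x) → 0 as x → +∞ exists if and only if F(1) + (d₂/d₁ − 1)·F(a) ≤ 0. -/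
open Set Filter Topology

/-- An admissible stationary profile for the two-diffusivity interface problem:
continuous on `ℝ`, C² away from `0`, values in `(0,1)`, solving
`d₁u'' + f(u) = 0` on `x < 0` and `d₂u'' + f(u) = 0` on `x > 0`, with
one-sided derivatives at `0` existing and matching fluxes
`d₁u'(0⁻) = d₂u'(0⁺)`. -/
def AdmissibleProfile (f : ℝ → ℝ) (d₁ d₂ : ℝ) (u : ℝ → ℝ) : Prop :=
  Continuous u ∧
  ContDiffOn ℝ 2 u (Iio 0) ∧ ContDiffOn ℝ 2 u (Ioi 0) ∧
  (∀ x : ℝ, 0 < u x ∧ u x < 1) ∧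
  (∀ x : ℝ, x < 0 →
    d₁ * derivWithin (derivWithin u (Iio 0)) (Iio 0) x + f (u x) = 0) ∧
  (∀ x : ℝ, 0 < x →
    d₂ * derivWithin (derivWithin u (Ioi 0)) (Ioi 0) x + f (u x) = 0) ∧
  DifferentiableWithinAt ℝ u (Iic 0) 0 ∧
  DifferentiableWithinAt ℝ u (Ici 0) 0 ∧
  d₁ * derivWithin u (Iic 0) 0 = d₂ * derivWithin u (Ici 0) 0


/-- A positive continuous density bounded below is the reciprocal speed of a global flow. -/
lemma exists_hasDerivAt_inv_of_le {h : ℝ → ℝ} (hc : Continuous h) {c : ℝ} (hc0 : 0 < c)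
    (hle : ∀ t, c ≤ h t) :
    ∃ φ : ℝ → ℝ, φ 0 = 0 ∧ Monotone φ ∧ Tendsto φ atTop atTop ∧
      ∀ x, HasDerivAt φ (h (φ x))⁻¹ x := by
  set T : ℝ → ℝ := fun t => ∫ r in (0:ℝ)..t, h r with hT
  have hTd : ∀ t, HasDerivAt T (h t) t := fun t =>
    intervalIntegral.integral_hasDerivAt_right (hc.intervalIntegrable _ _)
      hc.stronglyMeasurable.stronglyMeasurableAtFilter hc.continuousAt
  have hT0 : T 0 = 0 := by simp [hT]
  have hpos : ∀ t, 0 < h t := fun t => hc0.trans_le (hle t)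
  have hmono : StrictMono T := strictMono_of_deriv_pos fun t => by
    rw [(hTd t).deriv]; exact hpos t
  have hdiff : Monotone fun t => T t - c * t := by
    have hd : ∀ t, HasDerivAt (fun t => T t - c * t) (h t - c) t := fun t =>
      ((hTd t).sub ((hasDerivAt_id t).const_mul c)).congr_deriv (by simp)
    refine monotone_of_deriv_nonneg (fun t => (hd t).differentiableAt) fun t => ?_
    rw [(hd t).deriv]
    linarith [hle t]
  have htop : Tendsto T atTop atTop := by
    refine tendsto_atTop_mono' _ ?_ (tendsto_id.const_mul_atTop hc0)
    filter_upwards [eventually_ge_atTop 0] with t ht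
    have := hdiff ht
    simp only [hT0] at this
    simp only [id]
    linarith
  have hbot : Tendsto T atBot atBot := by
    refine tendsto_atBot_mono' _ ?_ (tendsto_id.const_mul_atBot hc0)
    filter_upwards [eventually_le_atBot 0] with t ht
    have := hdiff ht
    simp only [hT0] at this
    simp only [id]
    linarith
  have hTc : Continuous T := continuous_iff_continuousAt.2 fun t => (hTd t).continuousAt
  let e : ℝ ≃o ℝ := hmono.orderIsoOfSurjective T (hTc.surjective htop hbot)
  have he : ∀ x, T (e.symm x) = x := fun x => e.apply_symm_apply x
  refine ⟨e.symm, hmono.injective (by rw [he, hT0]), e.symm.monotone,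
    e.symm.tendsto_atTop, fun x => ?_⟩
  exact (hTd _).of_local_left_inverse e.symm.continuous.continuousAt (hpos _).ne'
    (Eventually.of_forall he)

/-- A scalar autonomous equation whose speed vanishes at most linearly at `0` has a positive
solution on the half-line that decays to `0`. -/
lemma exists_decaying_solution {G : ℝ → ℝ} {δ C : ℝ} (hδ : 0 < δ)
    (hG : ContinuousOn G (Ioc 0 δ)) (hpos : ∀ w ∈ Ioc 0 δ, 0 < G w)
    (hle : ∀ w ∈ Ioc 0 δ, G w ≤ C * w) :
    ∃ w : ℝ → ℝ, w 0 = δ ∧ (∀ x, 0 ≤ x → w x ∈ Ioc 0 δ) ∧ Tendsto w atTop (𝓝 0) ∧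
      ∀ x, 0 ≤ x → HasDerivAt w (-G (w x)) x := by
  have hδm : δ ∈ Ioc 0 δ := ⟨hδ, le_rfl⟩
  have hC : 0 < C := pos_of_mul_pos_left ((hpos δ hδm).trans_le (hle δ hδm)) hδ.le
  set r : ℝ → ℝ := fun t => δ * Real.exp (-max t 0) with hr
  have hrc : Continuous r := by fun_prop
  have hrm : ∀ t, r t ∈ Ioc 0 δ := fun t =>
    ⟨by positivity, mul_le_of_le_one_right hδ.le (Real.exp_le_one_iff.2 (by simp))⟩
  have hGr : Continuous fun t => G (r t) := hG.comp_continuous hrc hrm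
  obtain ⟨φ, hφ0, hφm, hφt, hφd⟩ := exists_hasDerivAt_inv_of_le
    (h := fun t => r t / G (r t)) (hrc.div hGr fun t => (hpos _ (hrm t)).ne')
    (inv_pos.2 hC) fun t => by
      rw [le_div_iff₀ (hpos _ (hrm t)), inv_mul_le_iff₀ hC]
      exact hle _ (hrm t)
  have hφnn : ∀ x, 0 ≤ x → 0 ≤ φ x := fun x hx => hφ0 ▸ hφm hx
  have hrφ : ∀ x, 0 ≤ x → r (φ x) = δ * Real.exp (-φ x) := fun x hx => by
    simp only [hr, max_eq_left (hφnn x hx)]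
  refine ⟨fun x => δ * Real.exp (-φ x), by simp [hφ0], fun x hx => ?_, ?_, fun x hx => ?_⟩
  · simpa only [← hrφ x hx] using hrm (φ x)
  · simpa using (Real.tendsto_exp_neg_atTop_nhds_zero.comp hφt).const_mul δ
  · have hG0 := (hpos _ (hrm (φ x))).ne'
    have hr0 := (hrm (φ x)).1.ne'
    refine ((hφd x).neg.exp.const_mul δ).congr_deriv ?_
    change δ * (Real.exp (-φ x) * -(r (φ x) / G (r (φ x)))⁻¹) = -G (δ * Real.exp (-φ x))
    rw [← mul_assoc, ← hrφ x hx]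
    field_simp

/-- A homoclinic half-orbit of `d w'' = P'(w)` at zero energy. -/
lemma exists_zero_energy_orbit {P p : ℝ → ℝ} {d δ : ℝ} (hd : 0 < d) (hδ : 0 < δ)
    (hp : ContDiff ℝ 1 p) (hP : ∀ w, HasDerivAt P (p w) w) (hp0 : p 0 = 0) (hP0 : P 0 = 0)
    (hpos : ∀ w ∈ Ioc 0 δ, 0 < P w) :
    ∃ w : ℝ → ℝ, w 0 = δ ∧ (∀ x, 0 ≤ x → w x ∈ Ioc 0 δ) ∧ Tendsto w atTop (𝓝 0) ∧
      (∀ x, 0 ≤ x → HasDerivAt w (-√(2 / d * P (w x))) x) ∧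
      ∀ x, 0 ≤ x → HasDerivAt (fun y => -√(2 / d * P (w y))) (p (w x) / d) x := by
  obtain ⟨K, hK⟩ := isCompact_Icc.exists_bound_of_continuousOn
    (s := Icc 0 δ) (hp.continuous_deriv le_rfl).continuousOn
  have hK0 : 0 ≤ K := (norm_nonneg _).trans (hK 0 ⟨le_rfl, hδ.le⟩)
  have hpb : ∀ w ∈ Icc 0 δ, ‖p w‖ ≤ K * w := fun w hw => by
    have := (convex_Icc 0 δ).norm_image_sub_le_of_norm_deriv_le (f := p)
      (fun x _ => (hp.differentiable one_ne_zero) x) hK ⟨le_rfl, hδ.le⟩ hw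
    simpa [hp0, abs_of_nonneg hw.1] using this
  have hPb : ∀ w ∈ Icc 0 δ, P w ≤ K * w ^ 2 := fun w hw => by
    have := (convex_Icc 0 w).norm_image_sub_le_of_norm_hasDerivWithin_le (f := P) (C := K * w)
      (fun x _ => (hP x).hasDerivWithinAt)
      (fun x hx => (hpb x ⟨hx.1, hx.2.trans hw.2⟩).trans (mul_le_mul_of_nonneg_left hx.2 hK0))
      ⟨le_rfl, hw.1⟩ ⟨hw.1, le_rfl⟩
    simp only [hP0, sub_zero, Real.norm_eq_abs, abs_of_nonneg hw.1] at this
    linarith [le_abs_self (P w)]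
  have hPc : Continuous P := continuous_iff_continuousAt.2 fun w => (hP w).continuousAt
  have hrad : ∀ w ∈ Ioc 0 δ, 0 < 2 / d * P w := fun w hw => mul_pos (by positivity) (hpos w hw)
  obtain ⟨w, hw0, hwm, hwt, hwd⟩ := exists_decaying_solution
    (G := fun w => √(2 / d * P w)) (C := √(2 / d * K)) hδ (by fun_prop)
    (fun w hw => Real.sqrt_pos.2 (hrad w hw)) fun w hw => by
      refine Real.sqrt_le_iff.2 ⟨by have := hw.1.le; positivity, ?_⟩
      rw [mul_pow, Real.sq_sqrt (by positivity), mul_assoc]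
      exact mul_le_mul_of_nonneg_left (hPb w ⟨hw.1.le, hw.2⟩) (by positivity)
  refine ⟨w, hw0, hwm, hwt, hwd, fun x hx => ?_⟩
  have hr := hrad _ (hwm x hx)
  have hs := (Real.sqrt_pos.2 hr).ne'
  refine ((((hP (w x)).comp x (hwd x hx)).const_mul (2 / d)).sqrt hr.ne').neg.congr_deriv ?_
  simp only [Function.comp_apply]
  set R := √(2 / d * P (w x))
  field_simp

/-- Smoothness and the second derivative from explicit first and second derivatives. -/
lemma contDiffOn_two_of_hasDerivAt {u v z : ℝ → ℝ} {s : Set ℝ} (hs : IsOpen s)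
    (hu : ∀ x ∈ s, HasDerivAt u (v x) x) (hv : ∀ x ∈ s, HasDerivAt v (z x) x)
    (hz : ContinuousOn z s) :
    ContDiffOn ℝ 2 u s ∧ ∀ x ∈ s, derivWithin (derivWithin u s) s x = z x := by
  have h1 : EqOn (derivWithin u s) v s := fun x hx =>
    (hu x hx).hasDerivWithinAt.derivWithin (hs.uniqueDiffWithinAt hx)
  have h2 : EqOn (derivWithin v s) z s := fun x hx =>
    (hv x hx).hasDerivWithinAt.derivWithin (hs.uniqueDiffWithinAt hx)
  have hv1 : ContDiffOn ℝ 1 v s := by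
    rw [show (1 : WithTop ℕ∞) = 0 + 1 by norm_num,
      contDiffOn_succ_iff_derivWithin hs.uniqueDiffOn]
    exact ⟨fun x hx => (hv x hx).differentiableAt.differentiableWithinAt, by simp,
      contDiffOn_zero.2 (hz.congr h2)⟩
  refine ⟨?_, fun x hx => ?_⟩
  · rw [show (2 : WithTop ℕ∞) = 1 + 1 by norm_num,
      contDiffOn_succ_iff_derivWithin hs.uniqueDiffOn]
    exact ⟨fun x hx => (hu x hx).differentiableAt.differentiableWithinAt, by simp,
      hv1.congr h1⟩
  · rw [derivWithin_congr h1 (h1 hx), h2 hx]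

/-- Energy identity on a half-line: the energy at the boundary is the potential at infinity. -/
lemma half_line_energy {Φ f u v : ℝ → ℝ} {d q ℓ : ℝ} (hd : 0 < d)
    (hΦ : ∀ s, HasDerivAt Φ (f s) s) (huc : Continuous u)
    (hu : ∀ x, 0 < x → HasDerivAt u (v x) x)
    (hv : ∀ x, 0 < x → HasDerivAt v (-(f (u x) / d)) x)
    (hq : HasDerivWithinAt u q (Ici 0) 0) (hℓ : Tendsto u atTop (𝓝 ℓ)) :
    d / 2 * q ^ 2 + Φ (u 0) = Φ ℓ := by
  set E : ℝ → ℝ := fun x => d / 2 * v x ^ 2 + Φ (u x)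
  have hEd : ∀ x ∈ Ioi (0:ℝ), HasDerivAt E 0 x := fun x hx => by
    refine ((((hv x hx).pow 2).const_mul (d / 2)).add
      ((hΦ (u x)).comp x (hu x hx))).congr_deriv ?_
    field_simp
    ring
  have hvsq : ∀ x, 0 < x → d / 2 * v x ^ 2 + Φ (u x) = E 1 := fun x hx =>
    isOpen_Ioi.is_const_of_deriv_eq_zero isPreconnected_Ioi
      (fun x hx => (hEd x hx).differentiableAt.differentiableWithinAt)
      (fun x hx => (hEd x hx).deriv) hx (show (0:ℝ) < 1 by norm_num)
  have hΦc : Continuous Φ := continuous_iff_continuousAt.2 fun s => (hΦ s).continuousAt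
  have hmvt : ∀ x y, 0 ≤ x → x < y → ∃ ξ ∈ Ioo x y, v ξ = (u y - u x) / (y - x) :=
    fun x y hx hxy => exists_hasDerivAt_eq_slope u v hxy huc.continuousOn
      fun z hz => hu z (hx.trans_lt hz.1)
  have hinf : E 1 = Φ ℓ := by
    have hex : ∀ x : ℝ, ∃ ξ, 0 ≤ x → x < ξ ∧ v ξ = u (x + 1) - u x := fun x => by
      by_cases hx : 0 ≤ x
      · obtain ⟨ξ, hξ, h⟩ := hmvt x (x + 1) hx (by linarith)
        exact ⟨ξ, fun _ => ⟨hξ.1, by simpa using h⟩⟩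
      · exact ⟨0, fun h => absurd h hx⟩
    choose ξ hξ using hex
    have hξt : Tendsto ξ atTop atTop := tendsto_atTop_mono' _
      ((eventually_ge_atTop 0).mono fun x hx => (hξ x hx).1.le) tendsto_id
    have hdiff : Tendsto (fun x => u (x + 1) - u x) atTop (𝓝 0) := by
      simpa using (hℓ.comp (tendsto_atTop_add_const_right _ 1 tendsto_id)).sub hℓ
    have hlim := ((hdiff.pow 2).const_mul (d / 2)).add
      ((hΦc.tendsto ℓ).comp (hℓ.comp hξt))
    have heq : Tendsto (fun x => d / 2 * (u (x + 1) - u x) ^ 2 + (Φ ∘ u ∘ ξ) x) atTop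
        (𝓝 (E 1)) := by
      refine tendsto_const_nhds.congr' ?_
      filter_upwards [eventually_ge_atTop 0] with x hx
      rw [← (hξ x hx).2]
      exact (hvsq _ (hx.trans_lt (hξ x hx).1)).symm
    simpa using tendsto_nhds_unique heq hlim
  rw [← hinf]
  have hex : ∀ y : ℝ, ∃ ξ, 0 < y → ξ ∈ Ioo 0 y ∧ v ξ = slope u 0 y := fun y => by
    by_cases hy : 0 < y
    · obtain ⟨ξ, hξ, h⟩ := hmvt 0 y le_rfl hy
      exact ⟨ξ, fun _ => ⟨hξ, by rw [h, slope_def_field]⟩⟩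
    · exact ⟨0, fun h => absurd h hy⟩
  choose ξ hξ using hex
  have hξt : Tendsto ξ (𝓝[>] 0) (𝓝 0) :=
    tendsto_of_tendsto_of_tendsto_of_le_of_le' tendsto_const_nhds
      (tendsto_id.mono_left nhdsWithin_le_nhds)
      (eventually_mem_nhdsWithin.mono fun y hy => (hξ y hy).1.1.le)
      (eventually_mem_nhdsWithin.mono fun y hy => (hξ y hy).1.2.le)
  have hsl : Tendsto (slope u 0) (𝓝[>] 0) (𝓝 q) := by
    exact (hasDerivWithinAt_iff_tendsto_slope' self_notMem_Ioi).1
      (hq.mono Ioi_subset_Ici_self)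
  have hlim := ((hsl.pow 2).const_mul (d / 2)).add
    (((hΦc.comp huc).tendsto 0).comp hξt)
  have heq : Tendsto (fun y => d / 2 * slope u 0 y ^ 2 + ((Φ ∘ u) ∘ ξ) y) (𝓝[>] 0)
      (𝓝 (E 1)) := by
    refine tendsto_const_nhds.congr' ?_
    filter_upwards [eventually_mem_nhdsWithin] with y hy
    rw [← (hξ y hy).2]
    exact (hvsq _ (hξ y hy).1.1).symm
  exact tendsto_nhds_unique hlim heq

lemma hasDerivAt_F {f : ℝ → ℝ} (hf : Continuous f) (s : ℝ) : HasDerivAt (F f) (f s) s :=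
  intervalIntegral.integral_hasDerivAt_right (hf.intervalIntegrable _ _)
    hf.stronglyMeasurable.stronglyMeasurableAtFilter hf.continuousAt

lemma F_zero (f : ℝ → ℝ) : F f 0 = 0 := intervalIntegral.integral_same

/-- First and second derivatives of a function that is `C²` on an open set. -/
lemma hasDerivAt_derivWithin_of_contDiffOn_two {u : ℝ → ℝ} {s : Set ℝ} (hs : IsOpen s)
    (hu : ContDiffOn ℝ 2 u s) {x : ℝ} (hx : x ∈ s) :
    HasDerivAt u (derivWithin u s x) x ∧
      HasDerivAt (derivWithin u s) (derivWithin (derivWithin u s) s x) x := by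
  rw [show (2 : WithTop ℕ∞) = 1 + 1 by norm_num,
    contDiffOn_succ_iff_derivWithin hs.uniqueDiffOn] at hu
  exact ⟨(hu.1 x hx).hasDerivWithinAt.hasDerivAt (hs.mem_nhds hx),
    ((hu.2.2.differentiableOn one_ne_zero) x hx).hasDerivWithinAt.hasDerivAt (hs.mem_nhds hx)⟩

namespace AdmissibleProfile

variable {f u : ℝ → ℝ} {d₁ d₂ ℓ : ℝ}

lemma energy_right (hf : Continuous f) (hd₂ : 0 < d₂) (hu : AdmissibleProfile f d₁ d₂ u)
    (hℓ : Tendsto u atTop (𝓝 ℓ)) :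
    d₂ / 2 * derivWithin u (Ici 0) 0 ^ 2 + F f (u 0) = F f ℓ := by
  obtain ⟨huc, -, hu2, -, -, heq, -, hdr, -⟩ := hu
  refine half_line_energy hd₂ (hasDerivAt_F hf) huc
    (fun x hx => (hasDerivAt_derivWithin_of_contDiffOn_two isOpen_Ioi hu2 hx).1)
    (fun x hx => ?_) hdr.hasDerivWithinAt hℓ
  convert (hasDerivAt_derivWithin_of_contDiffOn_two isOpen_Ioi hu2 hx).2 using 1
  rw [← neg_div, div_eq_iff hd₂.ne']
  linarith [heq x hx]

lemma energy_left (hf : Continuous f) (hd₁ : 0 < d₁) (hu : AdmissibleProfile f d₁ d₂ u)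
    (hℓ : Tendsto u atBot (𝓝 ℓ)) :
    d₁ / 2 * derivWithin u (Iic 0) 0 ^ 2 + F f (u 0) = F f ℓ := by
  obtain ⟨huc, hu1, -, -, heq, -, hdl, -, -⟩ := hu
  have hD := fun x (hx : 0 < x) => hasDerivAt_derivWithin_of_contDiffOn_two isOpen_Iio hu1
    (x := -x) (neg_lt_zero.2 hx)
  have key := half_line_energy (u := fun x => u (-x))
    (v := fun x => -derivWithin u (Iio 0) (-x)) (q := -derivWithin u (Iic 0) 0) (ℓ := ℓ)
    hd₁ (hasDerivAt_F hf) (huc.comp continuous_neg)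
    (fun x hx => ((hD x hx).1.comp x (hasDerivAt_neg x)).congr_deriv (by simp))
    (fun x hx => ?_) ?_ (hℓ.comp tendsto_neg_atTop_atBot)
  · simpa using key
  · refine ((hD x hx).2.comp x (hasDerivAt_neg x)).neg.congr_deriv (Eq.symm ?_)
    rw [← neg_div, div_eq_iff hd₁.ne']
    linarith [heq (-x) (neg_lt_zero.2 hx)]
  · have h0 : HasDerivWithinAt u (derivWithin u (Iic 0) 0) (Iic 0) (-0) := by
      simpa using hdl.hasDerivWithinAt
    exact (h0.comp (0:ℝ) (hasDerivWithinAt_neg (0:ℝ) (Ici 0))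
      (fun x hx => by simpa using hx)).congr_deriv (by simp)

end AdmissibleProfile

namespace Bistable

variable {f : ℝ → ℝ} {a s : ℝ}

lemma strictAntiOn_F (hf : Bistable f a) : StrictAntiOn (F f) (Icc 0 a) := by
  have hD := hasDerivAt_F hf.1.continuous
  refine strictAntiOn_of_deriv_neg (convex_Icc 0 a)
    (fun x _ => (hD x).continuousAt.continuousWithinAt) fun x hx => ?_
  rw [interior_Icc] at hx
  rw [(hD x).deriv]
  exact hf.2.2.2.2.2.2.1 x hx.1 hx.2

lemma strictMonoOn_F (hf : Bistable f a) : StrictMonoOn (F f) (Icc a 1) := by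
  have hD := hasDerivAt_F hf.1.continuous
  refine strictMonoOn_of_deriv_pos (convex_Icc a 1)
    (fun x _ => (hD x).continuousAt.continuousWithinAt) fun x hx => ?_
  rw [interior_Icc] at hx
  rw [(hD x).deriv]
  exact hf.2.2.2.2.2.2.2.1 x hx.1 hx.2

lemma F_one_pos (hf : Bistable f a) : 0 < F f 1 := hf.2.2.2.2.2.2.2.2.2.2.2

lemma F_threshold_le (hf : Bistable f a) (h0 : 0 ≤ s) (h1 : s ≤ 1) : F f a ≤ F f s := by
  rcases le_total s a with h | h
  · exact hf.strictAntiOn_F.antitoneOn ⟨h0, h⟩ ⟨hf.2.1.le, le_rfl⟩ h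
  · exact hf.strictMonoOn_F.monotoneOn ⟨le_rfl, hf.2.2.1.le⟩ ⟨h, h1⟩ h

lemma F_neg (hf : Bistable f a) (h0 : 0 < s) (h1 : s ≤ a) : F f s < 0 :=
  F_zero f ▸ hf.strictAntiOn_F ⟨le_rfl, hf.2.1.le⟩ ⟨h0.le, h1⟩ h0

lemma F_lt_F_one (hf : Bistable f a) (h0 : 0 < s) (h1 : s < 1) : F f s < F f 1 := by
  rcases le_total s a with h | h
  · exact (hf.F_neg h0 h).trans hf.F_one_pos
  · exact hf.strictMonoOn_F ⟨h, h1.le⟩ ⟨hf.2.2.1.le, le_rfl⟩ h1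

/-- Gluing the two half-orbits with interface value `m` gives a blocking profile. -/
lemma exists_profile (hf : Bistable f a) {d₁ d₂ m : ℝ} (hd₁ : 0 < d₁) (hd₂ : 0 < d₂)
    (hm0 : 0 < m) (hma : m ≤ a) (hflux : d₁ * (F f 1 - F f m) = d₂ * -F f m) :
    ∃ u : ℝ → ℝ, AdmissibleProfile f d₁ d₂ u ∧
      Tendsto u atBot (𝓝 1) ∧ Tendsto u atTop (𝓝 0) := by
  have hfc := hf.1.continuous
  have hm1 : m < 1 := hma.trans_lt hf.2.2.1
  obtain ⟨w, hw0, hwm, hwt, hwd, hwdd⟩ := exists_zero_energy_orbit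
    (P := fun s => -F f s) (p := fun s => -f s) hd₂ hm0 hf.1.neg
    (fun s => (hasDerivAt_F hfc s).neg) (by simp [hf.2.2.2.1]) (by simp [F_zero])
    fun s hs => neg_pos.2 (hf.F_neg hs.1 (hs.2.trans hma))
  obtain ⟨y, hy0, hym, hyt, hyd, hydd⟩ := exists_zero_energy_orbit
    (P := fun s => F f 1 - F f (1 - s)) (p := fun s => f (1 - s)) (δ := 1 - m) hd₁
    (by linarith) (hf.1.comp (contDiff_const.sub contDiff_id))
    (fun s => by
      simpa using ((hasDerivAt_F hfc (1 - s)).comp s ((hasDerivAt_id s).const_sub 1)).const_sub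
        (F f 1))
    (by simp [hf.2.2.2.2.2.1]) (by simp)
    fun s hs => sub_pos.2 (hf.F_lt_F_one (by linarith [hs.2]) (by linarith [hs.1]))
  set u : ℝ → ℝ := fun x => if x ≤ 0 then 1 - y (-x) else w x with hu
  have hul : EqOn u (fun x => 1 - y (-x)) (Iic 0) := fun x hx => if_pos hx
  have hur : EqOn u w (Ici 0) := fun x (hx : 0 ≤ x) => by
    rcases hx.eq_or_lt with rfl | hx
    · simp [hu, hy0, hw0]
    · exact if_neg hx.not_ge
  have hld : ∀ x, x ≤ 0 → HasDerivAt (fun x => 1 - y (-x))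
      (-√(2 / d₁ * (F f 1 - F f (1 - y (-x))))) x := fun x hx => by
    simpa using ((hyd (-x) (by linarith)).comp x (hasDerivAt_neg x)).const_sub 1
  have hldd : ∀ x, x ≤ 0 → HasDerivAt (fun x => -√(2 / d₁ * (F f 1 - F f (1 - y (-x)))))
      (-(f (1 - y (-x)) / d₁)) x := fun x hx => by
    simpa [Function.comp_def] using (hydd (-x) (by linarith)).comp x (hasDerivAt_neg x)
  have hl0 : HasDerivWithinAt u (-√(2 / d₁ * (F f 1 - F f m))) (Iic 0) 0 := by
    have h := (hld 0 le_rfl).hasDerivWithinAt (s := Iic 0)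
    simp only [neg_zero, hy0, sub_sub_cancel] at h
    exact h.congr hul (hul self_mem_Iic)
  have hr0 : HasDerivWithinAt u (-√(2 / d₂ * -F f m)) (Ici 0) 0 := by
    have h := (hwd 0 le_rfl).hasDerivWithinAt (s := Ici 0)
    rw [hw0] at h
    exact h.congr hur (hur self_mem_Ici)
  have hwc : ContinuousOn w (Ici 0) := fun x hx => (hwd x hx).continuousAt.continuousWithinAt
  have hlc : ContinuousOn (fun x => 1 - y (-x)) (Iic 0) := fun x hx =>
    (hld x hx).continuousAt.continuousWithinAt
  have huc : Continuous u := by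
    rw [← continuousOn_univ, ← Iic_union_Ici (a := (0:ℝ))]
    exact (hlc.congr hul).union_of_isClosed (hwc.congr hur) isClosed_Iic isClosed_Ici
  obtain ⟨hL, hL'⟩ := contDiffOn_two_of_hasDerivAt (u := u) isOpen_Iio
    (fun x (hx : x < 0) => (hld x hx.le).congr_of_eventuallyEq
      (hul.eventuallyEq_of_mem (Iic_mem_nhds hx)))
    (fun x (hx : x < 0) => hldd x hx.le)
    ((hfc.comp_continuousOn (hlc.mono Iio_subset_Iic_self)).div_const d₁).neg
  obtain ⟨hR, hR'⟩ := contDiffOn_two_of_hasDerivAt (u := u) isOpen_Ioi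
    (fun x (hx : 0 < x) => (hwd x hx.le).congr_of_eventuallyEq
      (hur.eventuallyEq_of_mem (Ici_mem_nhds hx)))
    (fun x (hx : 0 < x) => hwdd x hx.le)
    ((hfc.comp_continuousOn (hwc.mono Ioi_subset_Ici_self)).neg.div_const d₂)
  refine ⟨u, ⟨huc, hL, hR, fun x => ?_, fun x hx => ?_, fun x hx => ?_,
    hl0.differentiableWithinAt, hr0.differentiableWithinAt, ?_⟩, ?_, ?_⟩
  · rcases le_total x 0 with hx | hx
    · have := hym (-x) (by linarith)
      rw [hul hx]
      exact ⟨by linarith [this.2], by linarith [this.1]⟩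
    · rw [hur hx]
      exact ⟨(hwm x hx).1, (hwm x hx).2.trans_lt hm1⟩
  · rw [hL' x hx, hul hx.le]
    field_simp
    ring
  · rw [hR' x hx, hur hx.le]
    field_simp
    ring
  · rw [hl0.derivWithin (uniqueDiffOn_Iic 0 0 self_mem_Iic),
      hr0.derivWithin (uniqueDiffOn_Ici 0 0 self_mem_Ici), mul_neg, mul_neg, neg_inj]
    have key : ∀ {d A : ℝ}, 0 < d → d * √(2 / d * A) = √(2 * (d * A)) := fun {d A} hd => by
      nth_rewrite 1 [← Real.sqrt_sq hd.le]
      rw [← Real.sqrt_mul (sq_nonneg d)]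
      congr 1
      field_simp
    rw [key hd₁, key hd₂, hflux]
  · have h : Tendsto (fun x => 1 - y (-x)) atBot (𝓝 1) := by
      simpa using (hyt.comp tendsto_neg_atBot_atTop).const_sub 1
    exact h.congr' ((eventually_le_atBot 0).mono fun x hx => (hul hx).symm)
  · exact hwt.congr' ((eventually_ge_atTop 0).mono fun x hx => (hur hx).symm)

end Bistable

/-- Pauwelussen's criterion for the diffusion interface on the line:
(i) no blocking profile exists for fronts travelling from the high- to the
low-diffusivity side; (ii) a blocking profile for fronts travelling from the
low- to the high-diffusivity side exists iff `F(1) + (d₂/d₁ − 1)F(a) ≤ 0`. -/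
theorem interface_blocking_criterion (f : ℝ → ℝ) (a : ℝ) (hf : Bistable f a)
    (d₁ d₂ : ℝ) (hd₁ : 0 < d₁) (hd : d₁ ≤ d₂) :
    (¬ ∃ u : ℝ → ℝ, AdmissibleProfile f d₁ d₂ u ∧
      Tendsto u atTop (𝓝 1) ∧ Tendsto u atBot (𝓝 0)) ∧
    ((∃ u : ℝ → ℝ, AdmissibleProfile f d₁ d₂ u ∧
      Tendsto u atBot (𝓝 1) ∧ Tendsto u atTop (𝓝 0)) ↔
      F f 1 + (d₂ / d₁ - 1) * F f a ≤ 0) := by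
  have hfc := hf.1.continuous
  have hd₂ : 0 < d₂ := hd₁.trans_le hd
  have hF1 := hf.F_one_pos
  refine ⟨?_, ?_, fun h => ?_⟩
  · rintro ⟨u, hu, htop, hbot⟩
    have hr := hu.energy_right hfc hd₂ htop
    have hl := hu.energy_left hfc hd₁ hbot
    obtain ⟨-, -, -, -, -, -, -, -, hflux⟩ := hu
    rw [F_zero] at hl
    set p := derivWithin u (Iic 0) 0
    set q := derivWithin u (Ici 0) 0
    have hsq : d₁ * (d₁ * p ^ 2) = d₂ * (d₂ * q ^ 2) := by
      linear_combination (d₁ * p + d₂ * q) * hflux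
    have hle : d₁ * (d₁ * p ^ 2) ≤ d₂ * (d₁ * p ^ 2) :=
      mul_le_mul_of_nonneg_right hd (by positivity)
    have := le_of_mul_le_mul_left (hsq ▸ hle) hd₂
    linarith
  · rintro ⟨u, hu, hbot, htop⟩
    have hr := hu.energy_right hfc hd₂ htop
    have hl := hu.energy_left hfc hd₁ hbot
    obtain ⟨-, -, -, hbd, -, -, -, -, hflux⟩ := hu
    rw [F_zero] at hr
    have hmin := hf.F_threshold_le (hbd 0).1.le (hbd 0).2.le
    have hk : 0 ≤ d₂ / d₁ - 1 := sub_nonneg.2 ((one_le_div hd₁).2 hd)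
    have heq : F f 1 + (d₂ / d₁ - 1) * F f (u 0) = 0 := by
      field_simp
      linear_combination (d₁ * derivWithin u (Iic 0) 0 + d₂ * derivWithin u (Ici 0) 0) / 2 * hflux
        - d₁ * hl + d₂ * hr
    linarith [mul_le_mul_of_nonneg_left hmin hk]
  · have hFc : Continuous (F f) :=
      continuous_iff_continuousAt.2 fun s => (hasDerivAt_F hfc s).continuousAt
    have hc : ContinuousOn (fun s => F f 1 + (d₂ / d₁ - 1) * F f s) (Icc 0 a) := by fun_prop
    obtain ⟨m, hm, hm'⟩ := intermediate_value_Icc' hf.2.1.le hc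
      (show (0:ℝ) ∈ Icc _ _ from ⟨h, by simpa [F_zero] using hF1.le⟩)
    simp only at hm'
    have hm0 : 0 < m := hm.1.lt_of_ne fun h0 => by
      rw [← h0, F_zero] at hm'
      linarith
    refine hf.exists_profile hd₁ hd₂ hm0 hm.2 ?_
    field_simp at hm'
    linarith
end
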